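/- Let f : E(G*) → E(S10) be an S10-coloring of G* such that the edges of the circuit H' = H[f^{-1}(A1) ∩ E1] are alternately mapped to the two parallel edges joining x1 and y1 in S10, and let f_V : V(G*) → V(S10) be the induced vertex mapping (f_V(v) is the vertex u of S10 with f(∂_{G*}(v)) = ∂_{S10}(u)). Then f_V(V(H)) ⊆ {x1, y1, z1}. -/

import Mathlib

/-- A loopless multigraph: each edge has an unordered pair of distinct endpoints.
Parallel edges are allowed. -/
structure Multigraph (V : Type) (E : Type) where
  ends : E → Sym2 V
  loopless : ∀ e, ¬ (ends e).IsDiag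

namespace Multigraph

variable {V E V' E' V'' E'' : Type}

/-- `G.inc v` is the set `∂_G(v)` of edges of `G` incident with the vertex `v`. -/
def inc (G : Multigraph V E) (v : V) : Set E := {e | v ∈ G.ends e}

/-- Two edges are adjacent if they are distinct and share an endpoint. -/
def EdgeAdj (G : Multigraph V E) (e₁ e₂ : E) : Prop :=
  e₁ ≠ e₂ ∧ ∃ v, e₁ ∈ G.inc v ∧ e₂ ∈ G.inc v

/-- `f` is an `H`-coloring of `G`: a proper edge-coloring (adjacent edges of `G` receive
distinct images) such that for every vertex `v` of `G` there is a vertex `u` of `H` with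
`f(∂_G(v)) = ∂_H(u)`. -/
def IsColoring (G : Multigraph V E) (H : Multigraph V' E') (f : E → E') : Prop :=
  (∀ e₁ e₂, G.EdgeAdj e₁ e₂ → f e₁ ≠ f e₂) ∧
  (∀ v : V, ∃ u : V', f '' G.inc v = H.inc u)

end Multigraph

/-- The Sylvester graph `S₁₀`: vertex `0` is the centre `w`; vertices `1,2,3` are
`z₁,z₂,z₃`; vertices `4,5` are `x₁,y₁`; vertices `6,7` are `x₂,y₂`; vertices `8,9` are
`x₃,y₃`.  Edges `9,…,14` are the three pairs of parallel edges. -/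
def S10 : Multigraph (Fin 10) (Fin 15) where
  ends := ![s(0,1), s(0,2), s(0,3), s(1,4), s(1,5), s(2,6), s(2,7), s(3,8), s(3,9),
            s(4,5), s(4,5), s(6,7), s(6,7), s(8,9), s(8,9)]
  loopless := by decide

/-- `A₁` is the set of the six edges of `S₁₀` lying in a pair of parallel edges. -/
def A1 : Set (Fin 15) := {9, 10, 11, 12, 13, 14}

/-- The graph `G*`.  Vertices `0,…,8` induce the Petersen graph minus a vertex `v₀`
(vertices `0`, `3`, `4` are the former neighbours of `v₀`); vertex `9` is `u`;
vertices `10`, `11` are `s₁`, `s₂`; vertices `12,13,14` form the triangle `t₁t₂t₃`;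
vertices `15,…,23` are the three attached copies of `S₄` (with `17`, `20`, `23`
the vertices `c` joined to `s₁`, `s₂`, `t₃` respectively).
Edges `0,…,11` form `E₁` (the copy of the Petersen graph minus a vertex),
edges `12,…,23` form `E₂`, and edges `24,…,35` are the edges of the copies of `S₄`. -/
def Gstar : Multigraph (Fin 24) (Fin 36) where
  ends := ![s(0,1), s(1,2), s(2,3), s(0,5), s(1,6), s(2,7), s(3,8), s(4,6), s(4,7),
            s(5,7), s(5,8), s(6,8),
            s(9,10), s(9,11), s(9,12), s(12,13), s(13,14), s(12,14),
            s(10,0), s(11,3), s(13,4), s(10,17), s(11,20), s(14,23),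
            s(15,16), s(15,16), s(15,17), s(16,17),
            s(18,19), s(18,19), s(18,20), s(19,20),
            s(21,22), s(21,22), s(21,23), s(22,23)]
  loopless := by decide

/-- `E₁`: the edges of the subgraph `H` of `G*` isomorphic to the Petersen graph minus
a vertex. -/
def E1 : Set (Fin 36) := {e | e.val ≤ 11}

/-- `E₂`: the edges of `G*` belonging neither to `E₁` nor to a copy of `S₄`. -/
def E2 : Set (Fin 36) := {e | 12 ≤ e.val ∧ e.val ≤ 23}

/-- The edges of `S₁₀` sharing with the edge `a ≤ 10` one of the endpoints
`w`, `z₁`, `z₂`, `z₃`, `x₁`, `y₁`. -/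
def partners : ℕ → List ℕ
  | 0 => [1, 2, 3, 4]
  | 1 => [0, 2, 5, 6]
  | 2 => [0, 1, 7, 8]
  | 3 => [0, 4, 9, 10]
  | 4 => [0, 3, 9, 10]
  | 5 => [1, 6]
  | 6 => [1, 5]
  | 7 => [2, 8]
  | 8 => [2, 7]
  | 9 => [3, 4, 10]
  | 10 => [3, 4, 9]
  | _ => []

/-- The edges `c` of `S₁₀` such that `a`, `b`, `c` are the three edges at one of the vertices
`w`, `z₁`, `z₂`, `z₃`, `x₁`, `y₁`; the six sets of edges are encoded by binary masks. -/
def thirds (a b : ℕ) : List ℕ :=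
  (partners a).filter fun c =>
    let s := 2 ^ a + 2 ^ b + 2 ^ c
    s.beq 7 || s.beq 25 || s.beq 98 || s.beq 388 || s.beq 1544 || s.beq 1552

set_option synthInstance.maxSize 100000 in
set_option maxRecDepth 10000 in
/-- If the edges of the Petersen graph minus a vertex are coloured so that the colours at each
vertex extend to the star of one of `w`, `z₁`, `z₂`, `z₃`, `x₁`, `y₁`, then only the edges of
`S₁₀` incident with `z₁`, `x₁` or `y₁` occur as colours. -/
theorem petersen_sub_vertex_colors :
    ∀ e₁ ∈ List.range 11, ∀ e₂ ∈ partners e₁, ∀ e₅ ∈ thirds e₁ e₂,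
    ∀ e₀ ∈ partners e₁, ∀ e₄ ∈ thirds e₁ e₀, ∀ e₃ ∈ partners e₀, ∀ e₉ ∈ partners e₃,
    ∀ e₈ ∈ thirds e₅ e₉, ∀ e₁₀ ∈ thirds e₃ e₉, ∀ e₆ ∈ partners e₂, ∀ e₁₁ ∈ thirds e₁₀ e₆,
    ∀ e₇ ∈ thirds e₄ e₁₁, e₇ ∈ partners e₈ →
    ∀ e ∈ [e₀, e₁, e₂, e₃, e₄, e₅, e₆, e₇, e₈, e₉, e₁₀, e₁₁], e ∈ [0, 3, 4, 9, 10] := by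
  decide +kernel

theorem S10_mem_partners : ∀ (u : Fin 10) (a b : Fin 15), u ∈ S10.ends a → u ∈ S10.ends b →
    a ≠ b → a.val ≤ 10 → b.val ≤ 10 → b.val ∈ partners a.val := by
  decide +kernel

theorem S10_mem_thirds : ∀ (u : Fin 10) (a b c : Fin 15), u ∈ S10.ends a → u ∈ S10.ends b →
    u ∈ S10.ends c → a ≠ b → a ≠ c → b ≠ c → a.val ≤ 10 → b.val ≤ 10 →
    c.val ∈ thirds a.val b.val := by
  decide +kernel

theorem S10_vertex_of_two_edges : ∀ (u : Fin 10) (a b : Fin 15), u ∈ S10.ends a →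
    u ∈ S10.ends b → a ≠ b → a.val ∈ [0, 3, 4, 9, 10] → b.val ∈ [0, 3, 4, 9, 10] →
    u = 4 ∨ u = 5 ∨ u = 1 := by
  decide +kernel

theorem Gstar_two_edges_in_E1 : ∀ v : Fin 24, v.val ≤ 8 → ∃ a b : Fin 36,
    v ∈ Gstar.ends a ∧ v ∈ Gstar.ends b ∧ a ≠ b ∧ a.val ≤ 11 ∧ b.val ≤ 11 := by
  decide +kernel

/-- Let `f` be an `S₁₀`-coloring of `G*` whose circuit `H' = H[f⁻¹(A₁) ∩ E₁]` has all
its edges mapped (alternately) to the two parallel edges `9`, `10` joining `x₁ = 4` and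
`y₁ = 5` in `S₁₀`, and let `f_V` be the induced vertex mapping.  Then every vertex of
`H` (the vertices `0,…,8` of `G*`) is mapped to one of `x₁ = 4`, `y₁ = 5`, `z₁ = 1`. -/
theorem fV_of_H_in_x1_y1_z1 (f : Fin 36 → Fin 15) (hf : Gstar.IsColoring S10 f)
    (halt : ∀ e ∈ (f ⁻¹' A1) ∩ E1, f e = 9 ∨ f e = 10)
    (fV : Fin 24 → Fin 10) (hfV : ∀ v, f '' Gstar.inc v = S10.inc (fV v)) :
    ∀ v : Fin 24, v.val ≤ 8 → fV v ∈ ({4, 5, 1} : Set (Fin 10)) := by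
  have h_inc : ∀ v e, v ∈ Gstar.ends e → fV v ∈ S10.ends (f e) := fun v e he =>
    (hfV v).subset (Set.mem_image_of_mem f he)
  have h_ne : ∀ v a b, v ∈ Gstar.ends a → v ∈ Gstar.ends b → a ≠ b → f a ≠ f b :=
    fun v a b ha hb hab => hf.1 a b ⟨hab, v, ha, hb⟩
  have h_le : ∀ e : Fin 36, e.val ≤ 11 → (f e).val ≤ 10 := by
    intro e he
    by_contra! hlt
    have hA : f e ∈ A1 := by
      simp only [A1, Set.mem_insert_iff, Set.mem_singleton_iff]
      omega
    rcases halt e ⟨hA, he⟩ with h | h <;> simp [h] at hlt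
  have h_pair : ∀ v a b, v ∈ Gstar.ends a ∧ v ∈ Gstar.ends b ∧ a ≠ b ∧ a.val ≤ 11 ∧ b.val ≤ 11 →
      (f b).val ∈ partners (f a).val := fun v a b ⟨ha, hb, hab, la, lb⟩ =>
    S10_mem_partners (fV v) _ _ (h_inc v a ha) (h_inc v b hb) (h_ne v a b ha hb hab)
      (h_le a la) (h_le b lb)
  have h_star : ∀ v a b c, v ∈ Gstar.ends a ∧ v ∈ Gstar.ends b ∧ v ∈ Gstar.ends c ∧
      a ≠ b ∧ a ≠ c ∧ b ≠ c ∧ a.val ≤ 11 ∧ b.val ≤ 11 →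
      (f c).val ∈ thirds (f a).val (f b).val := fun v a b c ⟨ha, hb, hc, hab, hac, hbc, la, lb⟩ =>
    S10_mem_thirds (fV v) _ _ _ (h_inc v a ha) (h_inc v b hb) (h_inc v c hc)
      (h_ne v a b ha hb hab) (h_ne v a c ha hc hac) (h_ne v b c hb hc hbc) (h_le a la) (h_le b lb)
  have h_colors := petersen_sub_vertex_colors
    (f 1).val (List.mem_range.2 (Nat.lt_succ_of_le (h_le 1 (by decide))))
    (f 2).val (h_pair 2 1 2 (by decide)) (f 5).val (h_star 2 1 2 5 (by decide))
    (f 0).val (h_pair 1 1 0 (by decide)) (f 4).val (h_star 1 1 0 4 (by decide))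
    (f 3).val (h_pair 0 0 3 (by decide)) (f 9).val (h_pair 5 3 9 (by decide))
    (f 8).val (h_star 7 5 9 8 (by decide)) (f 10).val (h_star 5 3 9 10 (by decide))
    (f 6).val (h_pair 3 2 6 (by decide)) (f 11).val (h_star 8 10 6 11 (by decide))
    (f 7).val (h_star 6 4 11 7 (by decide)) (h_pair 4 8 7 (by decide))
  have h_mem : ∀ e : Fin 36, e.val ≤ 11 → (f e).val ∈ [0, 3, 4, 9, 10] := by
    rintro ⟨e, he⟩ hle
    apply h_colors
    dsimp only at hle
    interval_cases e <;> simp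
  intro v hv
  obtain ⟨a, b, ha, hb, hab, la, lb⟩ := Gstar_two_edges_in_E1 v hv
  exact S10_vertex_of_two_edges (fV v) (f a) (f b) (h_inc v a ha) (h_inc v b hb)
    (h_ne v a b ha hb hab) (h_mem a la) (h_mem b lb)
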